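/- arXiv:1912.09512 — 3 statements merged into one kernel-verified Lean document; each statement's English description precedes it below -/
import Mathlib

section
/- (Exchange step in the proof of Lemma 1.) Let A ⊆ ℕ be a finite set, let μ : ℕ → ℝ take values in [0,1] on A ∪ {i}, let j ∈ A, let i ∉ A, and suppose μ(i) ≥ μ(j). Then for every threshold Y ∈ ℕ, S(μ, (A \ {j}) ∪ {i}, Y) ≥ S(μ, A, Y). -/
/-- Success probability: probability that at least `Y` devices in `A` succeed. -/
noncomputable def S (μ : ℕ → ℝ) (A : Finset ℕ) (Y : ℕ) : ℝ :=
  ∑ A' ∈ A.powerset.filter (fun A' => Y ≤ A'.card),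
    (∏ ν ∈ A', μ ν) * (∏ ν ∈ A \ A', (1 - μ ν))

theorem S_insert (μ : ℕ → ℝ) {B : Finset ℕ} {a : ℕ} (ha : a ∉ B) (Y : ℕ) :
    S μ (insert a B) Y = μ a * S μ B (Y - 1) + (1 - μ a) * S μ B Y := by
  unfold S
  simp only [Finset.sum_filter]
  rw [Finset.sum_powerset_insert ha, add_comm, Finset.mul_sum, Finset.mul_sum]
  congr 1 <;> refine Finset.sum_congr rfl fun t ht => ?_
  all_goals
    have hat : a ∉ t := fun h => ha (Finset.mem_powerset.mp ht h)
  · rw [Finset.card_insert_of_notMem hat, Finset.prod_insert hat,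
      Finset.insert_sdiff_insert, Finset.sdiff_insert_of_notMem ha]
    simp only [← Nat.sub_le_iff_le_add, mul_ite, mul_zero, mul_assoc]
  · rw [Finset.insert_sdiff_of_notMem _ hat, Finset.prod_insert (by simp [ha])]
    simp only [mul_ite, mul_zero, mul_left_comm]

theorem S_antitone {μ : ℕ → ℝ} {B : Finset ℕ} (hμ : ∀ ν ∈ B, 0 ≤ μ ν ∧ μ ν ≤ 1) :
    Antitone (S μ B) := by
  intro X Y hXY
  refine Finset.sum_le_sum_of_subset_of_nonneg
    (Finset.monotone_filter_right _ fun _ _ h => hXY.trans h) fun t ht _ => ?_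
  have htB : t ⊆ B := Finset.mem_powerset.mp (Finset.mem_filter.mp ht).1
  exact mul_nonneg (Finset.prod_nonneg fun ν hν => (hμ ν (htB hν)).1)
    (Finset.prod_nonneg fun ν hν => sub_nonneg.mpr (hμ ν (Finset.mem_sdiff.mp hν).1).2)

theorem stmt_3 (A : Finset ℕ) (μ : ℕ → ℝ) (i j : ℕ)
    (hbound : ∀ ν ∈ insert i A, 0 ≤ μ ν ∧ μ ν ≤ 1)
    (hj : j ∈ A) (hi : i ∉ A) (hμ : μ j ≤ μ i)
    (Y : ℕ) :
    S μ A Y ≤ S μ (insert i (A.erase j)) Y := by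
  have hmono : S μ (A.erase j) Y ≤ S μ (A.erase j) (Y - 1) :=
    S_antitone (fun ν hν => hbound ν (Finset.mem_insert_of_mem (Finset.mem_of_mem_erase hν)))
      (Nat.sub_le Y 1)
  have hA := S_insert μ (Finset.notMem_erase j A) Y
  rw [Finset.insert_erase hj] at hA
  rw [hA, S_insert μ (fun h => hi (Finset.mem_of_mem_erase h))]
  linarith [mul_nonneg (sub_nonneg.mpr hμ) (sub_nonneg.mpr hmono)]
end

section
/- (Difference expansion, equation (eq:c).) Let A ⊆ ℕ be a finite set, let Y ∈ ℕ with 1 ≤ Y ≤ |A|, and let μ₁, μ₂ : ℕ → ℝ. Then S(μ₁, A, Y) − S(μ₂, A, Y) = ∑ over pairs (G₂, ν) with G₂ ⊆ A, |G₂| = Y, ν ∈ G₂ of (∏_{w ∈ G₂, w < ν} μ₁(w)) · (∏_{w ∈ A \ G₂, w < ν} (1 − μ₁(w))) · (μ₁(ν) − μ₂(ν)) · (∏_{w ∈ G₂ \ {ν}, w > ν} μ₂(w)) · (∏_{w ∈ A \ G₂, w > ν} (1 − μ₂(w))). -/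
/-- The probability that exactly the devices in `G` succeed among those in `A`. -/
noncomputable def outcomeProb (μ : ℕ → ℝ) (A G : Finset ℕ) : ℝ :=
  (∏ ν ∈ G, μ ν) * (∏ ν ∈ A \ G, (1 - μ ν))

/-- The contribution of the pair `(G, ν)` to the difference expansion: outcomes before `ν` are
weighted by `μ₁`, those after `ν` by `μ₂`. -/
noncomputable def hybridTerm (μ₁ μ₂ : ℕ → ℝ) (A G : Finset ℕ) (ν : ℕ) : ℝ :=
  (∏ w ∈ G.filter (fun w => w < ν), μ₁ w) *
    (∏ w ∈ (A \ G).filter (fun w => w < ν), (1 - μ₁ w)) *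
    (μ₁ ν - μ₂ ν) *
    (∏ w ∈ (G.erase ν).filter (fun w => ν < w), μ₂ w) *
    (∏ w ∈ (A \ G).filter (fun w => ν < w), (1 - μ₂ w))

theorem insert_sdiff_insert_of_notMem {a : ℕ} {s : Finset ℕ} (ha : a ∉ s) (t : Finset ℕ) :
    insert a s \ insert a t = s \ t := by
  grind

theorem outcomeProb_insert_left (μ : ℕ → ℝ) {a : ℕ} {s t : Finset ℕ} (ha : a ∉ s)
    (ht : t ⊆ s) : outcomeProb μ (insert a s) t = (1 - μ a) * outcomeProb μ s t := by
  have hat : a ∉ t := fun h => ha (ht h)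
  have has : a ∉ s \ t := fun h => ha (Finset.sdiff_subset h)
  rw [outcomeProb, outcomeProb, Finset.insert_sdiff_of_notMem _ hat, Finset.prod_insert has]
  ring

theorem outcomeProb_insert_insert (μ : ℕ → ℝ) {a : ℕ} {s t : Finset ℕ} (ha : a ∉ s)
    (ht : t ⊆ s) : outcomeProb μ (insert a s) (insert a t) = μ a * outcomeProb μ s t := by
  have hat : a ∉ t := fun h => ha (ht h)
  rw [outcomeProb, outcomeProb, insert_sdiff_insert_of_notMem ha, Finset.prod_insert hat]
  ring

theorem S_insert_succ (μ : ℕ → ℝ) {a : ℕ} {s : Finset ℕ} (ha : a ∉ s) (Y : ℕ) :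
    S μ (insert a s) (Y + 1) = μ a * S μ s Y + (1 - μ a) * S μ s (Y + 1) := by
  change ∑ t ∈ _, outcomeProb _ _ t =
    _ * (∑ t ∈ _, outcomeProb _ _ t) + _ * ∑ t ∈ _, outcomeProb _ _ t
  simp only [Finset.sum_filter, Finset.sum_powerset_insert ha, Finset.mul_sum]
  rw [add_comm]
  congr 1 <;> refine Finset.sum_congr rfl fun t ht => ?_
  · rw [Finset.mem_powerset] at ht
    rw [outcomeProb_insert_insert μ ha ht, Finset.card_insert_of_notMem fun h => ha (ht h)]
    simp
  · rw [Finset.mem_powerset] at ht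
    rw [outcomeProb_insert_left μ ha ht]
    simp

theorem S_zero (μ : ℕ → ℝ) (A : Finset ℕ) : S μ A 0 = 1 := by
  simp [S, ← Finset.prod_add]

theorem S_sub_S_succ (μ : ℕ → ℝ) (A : Finset ℕ) (Y : ℕ) :
    S μ A Y - S μ A (Y + 1) =
      ∑ t ∈ A.powerset.filter (fun t => t.card = Y), outcomeProb μ A t := by
  change (∑ t ∈ _, outcomeProb _ _ t) - ∑ t ∈ _, outcomeProb _ _ t = _
  simp only [Finset.sum_filter, ← Finset.sum_sub_distrib]
  refine Finset.sum_congr rfl fun t _ => ?_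
  split_ifs <;> first | omega | simp

theorem hybridTerm_insert_left (μ₁ μ₂ : ℕ → ℝ) {a ν : ℕ} {s t : Finset ℕ}
    (ha : ∀ x ∈ s, x < a) (ht : t ⊆ s) (hν : ν ∈ t) :
    hybridTerm μ₁ μ₂ (insert a s) t ν = (1 - μ₂ a) * hybridTerm μ₁ μ₂ s t ν := by
  have has : a ∉ s := fun h => (ha a h).false
  have hat : a ∉ t := fun h => has (ht h)
  have hlt : ν < a := ha ν (ht hν)
  rw [hybridTerm, hybridTerm, Finset.insert_sdiff_of_notMem _ hat, Finset.filter_insert,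
    Finset.filter_insert, if_neg hlt.not_gt, if_pos hlt, Finset.prod_insert (by simp [has])]
  ring

theorem hybridTerm_insert_insert (μ₁ μ₂ : ℕ → ℝ) {a ν : ℕ} {s t : Finset ℕ}
    (ha : ∀ x ∈ s, x < a) (ht : t ⊆ s) (hν : ν ∈ t) :
    hybridTerm μ₁ μ₂ (insert a s) (insert a t) ν = μ₂ a * hybridTerm μ₁ μ₂ s t ν := by
  have has : a ∉ s := fun h => (ha a h).false
  have hat : a ∉ t := fun h => has (ht h)
  have hlt : ν < a := ha ν (ht hν)
  rw [hybridTerm, hybridTerm, insert_sdiff_insert_of_notMem has,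
    Finset.erase_insert_of_ne hlt.ne', Finset.filter_insert,
    Finset.filter_insert, if_neg hlt.not_gt, if_pos hlt, Finset.prod_insert (by simp [hat])]
  ring

theorem hybridTerm_insert_insert_self (μ₁ μ₂ : ℕ → ℝ) {a : ℕ} {s t : Finset ℕ}
    (ha : ∀ x ∈ s, x < a) (ht : t ⊆ s) :
    hybridTerm μ₁ μ₂ (insert a s) (insert a t) a = (μ₁ a - μ₂ a) * outcomeProb μ₁ s t := by
  have has : a ∉ s := fun h => (ha a h).false
  have hat : a ∉ t := fun h => has (ht h)
  have h₁ : (insert a t).filter (fun w => w < a) = t := by grind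
  have h₂ : (s \ t).filter (fun w => w < a) = s \ t := by grind
  have h₃ : t.filter (fun w => a < w) = ∅ := by grind
  have h₄ : (s \ t).filter (fun w => a < w) = ∅ := by grind
  rw [hybridTerm, outcomeProb, insert_sdiff_insert_of_notMem has, Finset.erase_insert hat,
    h₁, h₂, h₃, h₄]
  simp only [Finset.prod_empty]
  ring

theorem sum_hybridTerm_insert_succ (μ₁ μ₂ : ℕ → ℝ) {a : ℕ} {s : Finset ℕ}
    (ha : ∀ x ∈ s, x < a) (Y : ℕ) :
    ∑ G ∈ (insert a s).powerset.filter (fun G => G.card = Y + 1),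
        ∑ ν ∈ G, hybridTerm μ₁ μ₂ (insert a s) G ν =
      (μ₁ a - μ₂ a) * ∑ G ∈ s.powerset.filter (fun G => G.card = Y), outcomeProb μ₁ s G +
        μ₂ a * ∑ G ∈ s.powerset.filter (fun G => G.card = Y), ∑ ν ∈ G, hybridTerm μ₁ μ₂ s G ν +
        (1 - μ₂ a) * ∑ G ∈ s.powerset.filter (fun G => G.card = Y + 1),
          ∑ ν ∈ G, hybridTerm μ₁ μ₂ s G ν := by
  have has : a ∉ s := fun h => (ha a h).false
  simp only [Finset.sum_filter, Finset.sum_powerset_insert has]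
  rw [add_comm]
  simp only [Finset.mul_sum (s := s.powerset), ← Finset.sum_add_distrib]
  refine Finset.sum_congr rfl fun t ht => ?_
  rw [Finset.mem_powerset] at ht
  have hat : a ∉ t := fun h => has (ht h)
  rw [Finset.card_insert_of_notMem hat, Finset.sum_insert hat,
    hybridTerm_insert_insert_self μ₁ μ₂ ha ht,
    Finset.sum_congr rfl fun ν hν => hybridTerm_insert_insert μ₁ μ₂ ha ht hν,
    Finset.sum_congr rfl fun ν hν => hybridTerm_insert_left μ₁ μ₂ ha ht hν,
    ← Finset.mul_sum, ← Finset.mul_sum]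
  simp only [Nat.add_right_cancel_iff]
  split_ifs <;> ring

theorem S_sub_S_eq_sum_hybridTerm (μ₁ μ₂ : ℕ → ℝ) (A : Finset ℕ) (Y : ℕ) :
    S μ₁ A Y - S μ₂ A Y =
      ∑ G ∈ A.powerset.filter (fun G => G.card = Y), ∑ ν ∈ G, hybridTerm μ₁ μ₂ A G ν := by
  induction A using Finset.induction_on_max generalizing Y with
  | empty =>
    have h : S μ₁ ∅ Y = S μ₂ ∅ Y := by simp [S, Finset.sum_filter]
    simp only [h, sub_self, Finset.sum_filter, Finset.powerset_empty, Finset.sum_singleton,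
      Finset.sum_empty, ite_self]
  | insert a s ha ih =>
    have has : a ∉ s := fun h => (ha a h).false
    cases Y with
    | zero =>
      rw [S_zero, S_zero, sub_self, eq_comm]
      refine Finset.sum_eq_zero fun G hG => ?_
      rw [Finset.card_eq_zero.mp (Finset.mem_filter.mp hG).2, Finset.sum_empty]
    | succ Y =>
      rw [sum_hybridTerm_insert_succ μ₁ μ₂ ha, ← ih Y, ← ih (Y + 1), ← S_sub_S_succ,
        S_insert_succ μ₁ has, S_insert_succ μ₂ has]
      ring

theorem stmt_8 (A : Finset ℕ) (Y : ℕ) (hY1 : 1 ≤ Y) (hY2 : Y ≤ A.card)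
    (μ₁ μ₂ : ℕ → ℝ) :
    S μ₁ A Y - S μ₂ A Y
      = ∑ G₂ ∈ A.powerset.filter (fun G => G.card = Y), ∑ ν ∈ G₂,
          (∏ w ∈ G₂.filter (fun w => w < ν), μ₁ w) *
            (∏ w ∈ (A \ G₂).filter (fun w => w < ν), (1 - μ₁ w)) *
            (μ₁ ν - μ₂ ν) *
            (∏ w ∈ (G₂.erase ν).filter (fun w => ν < w), μ₂ w) *
            (∏ w ∈ (A \ G₂).filter (fun w => ν < w), (1 - μ₂ w)) :=
  S_sub_S_eq_sum_hybridTerm μ₁ μ₂ A Y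
end

section
/- (Recovery threshold of Lagrange coded computing, equation (4).) Let F be a field, let k ≥ 1, let β₁, …, β_k ∈ F be distinct, and let x₁, …, x_k ∈ F. Let m ∈ F[X] be the Lagrange interpolation polynomial of degree at most k − 1 with m(β_j) = x_j for all j. Let f ∈ F[X] be a polynomial with deg f ≤ d. Set N = (k − 1)·d + 1, and let α₁, …, α_N ∈ F be distinct evaluation points. Then any polynomial g ∈ F[X] of degree at most (k − 1)·d satisfying g(α_v) = f(m(α_v)) for all v = 1, …, N equals f ∘ m; in particular g(β_j) = f(x_j) for every j, so the values f(m(α_v)) at any (k−1)deg(f)+1 points recover all of f(x₁), …, f(x_k). -/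
open Polynomial

theorem stmt_17 {F : Type*} [Field F] (k : ℕ) (hk : 1 ≤ k)
    (β : Fin k → F) (hβ : Function.Injective β) (x : Fin k → F)
    (m : F[X]) (hm : m.natDegree ≤ k - 1) (hmβ : ∀ j, m.eval (β j) = x j)
    (f : F[X]) (d : ℕ) (hf : f.natDegree ≤ d)
    (α : Fin ((k - 1) * d + 1) → F) (hα : Function.Injective α)
    (g : F[X]) (hg : g.natDegree ≤ (k - 1) * d)
    (hgα : ∀ v, g.eval (α v) = f.eval (m.eval (α v))) :
    g = f.comp m ∧ ∀ j, g.eval (β j) = f.eval (x j) := by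
  have hcomp : (f.comp m).natDegree ≤ (k - 1) * d := by
    rw [natDegree_comp, mul_comm (k - 1)]
    exact Nat.mul_le_mul hf hm
  have hg_eq : g = f.comp m := by
    refine eq_of_natDegree_lt_card_of_eval_eq g (f.comp m) hα (fun v => ?_) ?_
    · rw [hgα, eval_comp]
    · rw [Fintype.card_fin]
      exact Nat.lt_succ_of_le (max_le hg hcomp)
  refine ⟨hg_eq, fun j => ?_⟩
  rw [hg_eq, eval_comp, hmβ]
end
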